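/- If s is an interior point of the solvability interval, i.e. inf I(p₀) < s < sup I(p₀), then the equation (φ(x'(t)))' + a·x'(t) + b·sin(x(t)) = p₀(t) + s has at least two geometrically distinct T-periodic solutions, that is, two T-periodic solutions x₁, x₂ such that for no integer k does x₁(t) = x₂(t) + 2kπ hold for all t. -/

import Mathlib

open Real Set MeasureTheory

/-- The relativistic operator `φ(v) = v / √(1 - v²/c²)`. -/
noncomputable def phi (c v : ℝ) : ℝ := v / Real.sqrt (1 - v ^ 2 / c ^ 2)

/-- `x` is a `T`-periodic solution of the relativistic pendulum equation
`(φ(x'))' + a x' + b sin x = p`. -/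
def IsPendSol (c a b T : ℝ) (p x : ℝ → ℝ) : Prop :=
  Function.Periodic x T ∧
  ContDiff ℝ 1 x ∧
  (∀ t : ℝ, |deriv x t| < c) ∧
  ContDiff ℝ 1 (fun t : ℝ => phi c (deriv x t)) ∧
  ∀ t : ℝ, deriv (fun τ : ℝ => phi c (deriv x τ)) t + a * deriv x t + b * Real.sin (x t) = p t

/-- The solvability set `I(p₀)`: the values `s` for which the relativistic pendulum
equation with forcing `p₀ + s` has a `T`-periodic solution. -/
def solvSet (c a b T : ℝ) (p₀ : ℝ → ℝ) : Set ℝ :=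
  {s : ℝ | ∃ x : ℝ → ℝ, IsPendSol c a b T (fun t => p₀ t + s) x}


/-- inverse of the relativistic operator -/
noncomputable def psi (c y : ℝ) : ℝ := y / Real.sqrt (1 + y ^ 2 / c ^ 2)

lemma psi_zero (c : ℝ) : psi c 0 = 0 := by simp [psi]

lemma psi_hasDerivAt (c : ℝ) (y : ℝ) :
    HasDerivAt (psi c) (1 / ((1 + y ^ 2 / c ^ 2) * Real.sqrt (1 + y ^ 2 / c ^ 2))) y := by
  have hpos : 0 < 1 + y ^ 2 / c ^ 2 := by positivity
  have h1 : HasDerivAt (fun y : ℝ => 1 + y ^ 2 / c ^ 2) (2 * y / c ^ 2) y := by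
    have := ((hasDerivAt_pow 2 y).div_const (c ^ 2)).const_add 1
    simpa using this
  have h2 := h1.sqrt hpos.ne'
  have hs : 0 < Real.sqrt (1 + y ^ 2 / c ^ 2) := Real.sqrt_pos.mpr hpos
  have h3 := (hasDerivAt_id y).div h2 hs.ne'
  refine h3.congr_deriv ?_
  have hsq : Real.sqrt (1 + y ^ 2 / c ^ 2) ^ 2 = 1 + y ^ 2 / c ^ 2 := Real.sq_sqrt hpos.le
  set r := Real.sqrt (1 + y ^ 2 / c ^ 2)
  rw [← hsq]
  have e : y * (2 * y / c ^ 2 / (2 * r)) = (r ^ 2 - 1) / r := by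
    rw [hsq]; field_simp; ring
  simp only [id, one_mul]
  rw [e]
  field_simp
  ring

lemma psi_strictMono (c : ℝ) : StrictMono (psi c) := by
  apply strictMono_of_deriv_pos
  intro y
  rw [(psi_hasDerivAt c y).deriv]
  positivity

lemma psi_lipschitz (c : ℝ) : LipschitzWith 1 (psi c) := by
  apply lipschitzWith_of_nnnorm_deriv_le (fun y => (psi_hasDerivAt c y).differentiableAt)
  intro y
  rw [(psi_hasDerivAt c y).deriv]
  rw [← NNReal.coe_le_coe]
  simp only [coe_nnnorm, NNReal.coe_one, Real.norm_eq_abs]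
  have h1 : 1 ≤ 1 + y ^ 2 / c ^ 2 := by
    have : 0 ≤ y ^ 2 / c ^ 2 := by positivity
    linarith
  have h2 : 1 ≤ Real.sqrt (1 + y ^ 2 / c ^ 2) := Real.one_le_sqrt.mpr h1
  rw [abs_of_pos (by positivity), div_le_one (by positivity)]
  nlinarith

lemma psi_dist (c y z : ℝ) : |psi c y - psi c z| ≤ |y - z| := by
  have := (psi_lipschitz c).dist_le_mul y z
  simpa [Real.dist_eq] using this

lemma psi_continuous (c : ℝ) : Continuous (psi c) := (psi_lipschitz c).continuous

lemma psi_neg (c y : ℝ) : psi c (-y) = - psi c y := by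
  simp [psi, neg_div]

lemma psi_abs_lt {c : ℝ} (hc : 0 < c) (y : ℝ) : |psi c y| < c := by
  have hpos : 0 < 1 + y ^ 2 / c ^ 2 := by positivity
  have hs : 0 < Real.sqrt (1 + y ^ 2 / c ^ 2) := Real.sqrt_pos.mpr hpos
  rw [psi, abs_div, abs_of_pos hs, div_lt_iff₀ hs]
  have : |y| / c < Real.sqrt (1 + y ^ 2 / c ^ 2) := by
    apply Real.lt_sqrt_of_sq_lt
    rw [div_pow, sq_abs]; linarith
  rw [div_lt_iff₀ hc] at this
  linarith

lemma psi_c_ge {c : ℝ} (hc : 0 < c) : c / 2 ≤ psi c c := by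
  rw [psi, div_self (by positivity)]
  have : Real.sqrt (1 + 1) ≤ 2 := by
    rw [Real.sqrt_le_left (by norm_num)]; norm_num
  have h0 : 0 < Real.sqrt (1 + 1) := by positivity
  exact div_le_div_of_nonneg_left hc.le h0 this

lemma phi_psi {c : ℝ} (hc : 0 < c) (y : ℝ) : phi c (psi c y) = y := by
  have hpos : 0 < 1 + y ^ 2 / c ^ 2 := by positivity
  have hs : 0 < Real.sqrt (1 + y ^ 2 / c ^ 2) := Real.sqrt_pos.mpr hpos
  have hsq : Real.sqrt (1 + y ^ 2 / c ^ 2) ^ 2 = 1 + y ^ 2 / c ^ 2 := Real.sq_sqrt hpos.le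
  have : 1 - (psi c y) ^ 2 / c ^ 2 = ((Real.sqrt (1 + y ^ 2 / c ^ 2))⁻¹) ^ 2 := by
    rw [psi, div_pow, inv_pow, hsq]
    field_simp
    ring
  rw [phi, this, Real.sqrt_sq (by positivity), psi]
  field_simp

lemma psi_phi {c : ℝ} (hc : 0 < c) {v : ℝ} (hv : |v| < c) : psi c (phi c v) = v := by
  have hlt : v ^ 2 < c ^ 2 := by
    rw [← sq_abs v]; exact pow_lt_pow_left₀ hv (abs_nonneg _) (by norm_num)
  have hpos : 0 < 1 - v ^ 2 / c ^ 2 := by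
    rw [sub_pos, div_lt_one (by positivity)]; exact hlt
  have hs : 0 < Real.sqrt (1 - v ^ 2 / c ^ 2) := Real.sqrt_pos.mpr hpos
  have hsq : Real.sqrt (1 - v ^ 2 / c ^ 2) ^ 2 = 1 - v ^ 2 / c ^ 2 := Real.sq_sqrt hpos.le
  have : 1 + (phi c v) ^ 2 / c ^ 2 = ((Real.sqrt (1 - v ^ 2 / c ^ 2))⁻¹) ^ 2 := by
    rw [phi, div_pow, inv_pow, hsq]
    have h0 : c ^ 2 - v ^ 2 ≠ 0 := by linarith
    field_simp
    ring
  rw [psi, this, Real.sqrt_sq (by positivity), phi]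
  rw [div_inv_eq_mul, div_mul_cancel₀ _ hs.ne']

lemma no_ext (f g : ℂ → ℂ) (ρ : ℝ) (hρ : 0 < ρ) (hf : Continuous f) (hf0 : ∀ z, f z ≠ 0)
    (hg : ContinuousOn g {z | ‖z‖ = ρ})
    (h : ∀ z : ℂ, ‖z‖ = ρ → f z = (starRingEnd ℂ) z * Complex.exp (g z)) : False := by
  have hsc : IsSimplyConnected (univ : Set ℂ) := by
    have : ContractibleSpace (univ : Set ℂ) := (Homeomorph.Set.univ ℂ).contractibleSpace
    exact (inferInstance : SimplyConnectedSpace (univ : Set ℂ))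
  obtain ⟨w, hw, hwe⟩ := Complex.exists_continuousOn_eqOn_exp_comp hsc isOpen_univ
    hf.continuousOn (by simpa using fun x => hf0 x)
  rw [continuousOn_univ] at hw
  let e : ℝ → ℂ := fun θ => ρ * Complex.exp (θ * Complex.I)
  have hec : Continuous e := by fun_prop
  have hen : ∀ θ, ‖e θ‖ = ρ := by
    intro θ
    simp [e, Complex.norm_exp_ofReal_mul_I, abs_of_pos hρ]
  let u : ℝ → ℂ := fun θ => w (e θ) - g (e θ) - Real.log ρ + θ * Complex.I
  have huc : Continuous u := by
    have : Continuous fun θ => g (e θ) := hg.comp_continuous hec hen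
    have h2 : Continuous fun θ => w (e θ) := hw.comp hec
    exact ((h2.sub this).sub continuous_const).add (by fun_prop)
  have hexp : ∀ θ, Complex.exp (u θ) = 1 := by
    intro θ
    have h1 : Complex.exp (w (e θ)) = f (e θ) := hwe (mem_univ _)
    have hr : (starRingEnd ℂ) (e θ) = ρ * Complex.exp (-(θ * Complex.I)) := by
      simp [e, ← Complex.exp_conj]
    have hlog : Complex.exp (Real.log ρ : ℝ) = ρ := by
      rw [← Complex.ofReal_exp, Real.exp_log hρ]
    simp only [u]
    rw [Complex.exp_add, Complex.exp_sub, Complex.exp_sub, h1, h _ (hen θ), hr, hlog, Complex.exp_neg]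
    have : (ρ : ℂ) ≠ 0 := by exact_mod_cast hρ.ne'
    have h3 := Complex.exp_ne_zero (g (e θ))
    have h4 := Complex.exp_ne_zero (θ * Complex.I)
    field_simp
  have hinteg : ∀ θ, ∃ n : ℤ, u θ = n * (2 * π * Complex.I) := fun θ => Complex.exp_eq_one_iff.mp (hexp θ)
  choose n hn using hinteg
  -- continuous with integer values
  have hv : Continuous fun θ => (u θ).im / (2 * π) := by fun_prop
  have hvn : ∀ θ, (u θ).im / (2 * π) = n θ := by
    intro θ; rw [hn θ]; simp
  have hnc : Continuous fun θ => ((n θ : ℤ) : ℝ) := by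
    simpa only [hvn] using hv
  have hnc' : Continuous n := Int.isClosedEmbedding_coe_real.isInducing.continuous_iff.mpr hnc
  have hconst : n 0 = n (2 * π) := PreconnectedSpace.constant inferInstance hnc'
  have he : e (2 * π) = e 0 := by simp [e]
  have h0 := hvn 0
  have h1 := hvn (2 * π)
  rw [← hconst, ← h0] at h1
  have : 0 < 2 * π := by positivity
  rw [div_left_inj' this.ne'] at h1
  simp [u, he] at h1

/-- `Φ` is the global flow of `F` started at time zero. -/
def IsFlow (F : ℝ → ℂ → ℂ) (Φ : ℂ → ℝ → ℂ) : Prop :=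
  ∀ z, Φ z 0 = z ∧ ∀ t, HasDerivAt (Φ z) (F t (Φ z t)) t

lemma exists_flow (F : ℝ → ℂ → ℂ) (K L : NNReal) (hK : ∀ t, LipschitzWith K (F t))
    (hc : ∀ z, Continuous fun t => F t z) (hL : ∀ t z, ‖F t z‖ ≤ L) :
    ∃ Φ, IsFlow F Φ := by
  have key : ∀ z : ℂ, ∃ u : ℝ → ℂ, u 0 = z ∧ ∀ t, HasDerivAt u (F t (u t)) t := by
    intro z
    have h1 : ∀ n : ℕ, ∃ u : ℝ → ℂ, u 0 = z ∧
        ∀ t ∈ Ioo (-((n : ℝ) + 1)) (n + 1), HasDerivAt u (F t (u t)) t := by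
      intro n
      have hmem : (0 : ℝ) ∈ Icc (-((n : ℝ) + 1)) (n + 1) := ⟨by linarith [n.cast_nonneg (α := ℝ)], by positivity⟩
      have hPL : IsPicardLindelof F (⟨0, hmem⟩ : Icc (-((n : ℝ) + 1)) ((n : ℝ) + 1)) z
          (L * (n + 1)) 0 L K := by
        refine ⟨fun t _ => (hK t).lipschitzOnWith, fun x _ => (hc x).continuousOn,
          fun t _ x _ => hL t x, ?_⟩
        simp
      obtain ⟨u, hu0, hu⟩ := hPL.exists_eq_forall_mem_Icc_hasDerivWithinAt₀
      refine ⟨u, hu0, fun t ht => ?_⟩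
      exact (hu t (Ioo_subset_Icc_self ht)).hasDerivAt (Icc_mem_nhds ht.1 ht.2)
    choose u hu0 hu using h1
    have huniq : ∀ m n : ℕ, m ≤ n → EqOn (u m) (u n) (Ioo (-((m : ℝ) + 1)) (m + 1)) := by
      intro m n hmn
      have hmn' : (m : ℝ) ≤ n := by exact_mod_cast hmn
      have hm0 : (0 : ℝ) ≤ m := m.cast_nonneg
      refine ODE_solution_unique_of_mem_Ioo (v := F) (s := fun _ => univ) (K := K) (t₀ := 0)
        (fun t _ => (hK t).lipschitzOnWith) ⟨by linarith, by linarith⟩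
        (fun t ht => ⟨hu m t ht, mem_univ _⟩)
        (fun t ht => ⟨hu n t ⟨by linarith [ht.1], by linarith [ht.2]⟩, mem_univ _⟩) ?_
      rw [hu0, hu0]
    let N : ℝ → ℕ := fun t => ⌈|t|⌉₊
    have hN : ∀ t, |t| ≤ N t := fun t => Nat.le_ceil _
    have heq : ∀ (n : ℕ) (t : ℝ), |t| < n + 1 → u (N t) t = u n t := by
      intro n t ht
      have h2 : |t| < (N t : ℝ) + 1 := by linarith [hN t]
      rcases le_total (N t) n with h | h
      · exact huniq _ _ h (abs_lt.mp h2)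
      · exact (huniq _ _ h (abs_lt.mp ht)).symm
    refine ⟨fun t => u (N t) t, hu0 _, fun t => ?_⟩
    have h3 : |t| < (N t : ℝ) + 1 := by linarith [hN t]
    have h4 : (fun τ => u (N τ) τ) =ᶠ[nhds t] u (N t) := by
      have : {τ : ℝ | |τ| < (N t : ℝ) + 1} ∈ nhds t :=
        (isOpen_lt continuous_abs continuous_const).mem_nhds h3
      filter_upwards [this] with τ hτ
      exact heq _ _ hτ
    exact (hu (N t) t (abs_lt.mp h3)).congr_of_eventuallyEq h4
  choose Φ h using key
  exact ⟨Φ, h⟩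

lemma IsFlow.dist_le {F : ℝ → ℂ → ℂ} {Φ : ℂ → ℝ → ℂ} (h : IsFlow F Φ) {K : NNReal}
    (hK : ∀ t, LipschitzWith K (F t)) (z w : ℂ) {t : ℝ} (ht : 0 ≤ t) :
    dist (Φ z t) (Φ w t) ≤ dist z w * Real.exp (K * t) := by
  have := dist_le_of_trajectories_ODE (v := F) (K := K) (f := Φ z) (g := Φ w) (a := 0) (b := t)
    (δ := dist z w) hK
    (fun τ _ => ((h z).2 τ).continuousAt.continuousWithinAt)
    (fun τ _ => ((h z).2 τ).hasDerivWithinAt)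
    (fun τ _ => ((h w).2 τ).continuousAt.continuousWithinAt)
    (fun τ _ => ((h w).2 τ).hasDerivWithinAt) (by rw [(h z).1, (h w).1]) t ⟨ht, le_rfl⟩
  simpa using this

lemma IsFlow.continuous_time {F : ℝ → ℂ → ℂ} {Φ : ℂ → ℝ → ℂ} (h : IsFlow F Φ) {K : NNReal}
    (hK : ∀ t, LipschitzWith K (F t)) {T : ℝ} (hT : 0 ≤ T) :
    Continuous fun z => Φ z T := by
  have : LipschitzWith (Real.toNNReal (Real.exp (K * T))) (fun z => Φ z T) := by
    apply LipschitzWith.of_dist_le_mul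
    intro z w
    rw [Real.coe_toNNReal _ (Real.exp_pos _).le, mul_comm]
    exact h.dist_le hK z w hT
  exact this.continuous

/-- uniqueness on `[0, T]` -/
lemma IsFlow.eq_of_sol {F : ℝ → ℂ → ℂ} {Φ : ℂ → ℝ → ℂ} (h : IsFlow F Φ) {K : NNReal}
    (hK : ∀ t, LipschitzWith K (F t)) {T : ℝ} {u : ℝ → ℂ} (hu : Continuous u)
    (hu' : ∀ t ∈ Icc 0 T, HasDerivAt u (F t (u t)) t) :
    ∀ t ∈ Icc 0 T, Φ (u 0) t = u t := by
  have := ODE_solution_unique (v := F) (K := K) (f := Φ (u 0)) (g := u) (a := 0) (b := T) hK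
    (fun τ _ => ((h _).2 τ).continuousAt.continuousWithinAt)
    (fun τ _ => ((h _).2 τ).hasDerivWithinAt)
    hu.continuousOn
    (fun τ hτ => (hu' τ (Ico_subset_Icc_self hτ)).hasDerivWithinAt) (h _).1
  exact this

lemma IsFlow.periodic {F : ℝ → ℂ → ℂ} {Φ : ℂ → ℝ → ℂ} (h : IsFlow F Φ) {K : NNReal}
    (hK : ∀ t, LipschitzWith K (F t)) {T : ℝ} (hF : ∀ t z, F (t + T) z = F t z) {z : ℂ}
    (hz : Φ z T = z) : Function.Periodic (Φ z) T := by
  have : (fun t => Φ z (t + T)) = Φ z := by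
    refine ODE_solution_unique_univ (v := F) (s := fun _ => univ) (K := K) (t₀ := 0)
      (fun t => (hK t).lipschitzOnWith) (fun t => ⟨?_, mem_univ _⟩)
      (fun t => ⟨(h z).2 t, mem_univ _⟩) ?_
    · have := ((h z).2 (t + T)).comp_add_const t T
      rwa [hF] at this
    · simp [hz, (h z).1]
  exact fun t => congrFun this t

/-- two flows agree near a point whose trajectory stays in a region where the fields agree -/
lemma flow_local_eq {F₁ F₂ : ℝ → ℂ → ℂ} {Φ₁ Φ₂ : ℂ → ℝ → ℂ} (h₁ : IsFlow F₁ Φ₁)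
    (h₂ : IsFlow F₂ Φ₂) {K : NNReal}
    (hK₁ : ∀ t, LipschitzWith K (F₁ t)) (hK₂ : ∀ t, LipschitzWith K (F₂ t)) {T : ℝ} (hT : 0 ≤ T)
    {A B : ℝ → ℝ} (hA : Continuous A) (hB : Continuous B)
    (hag : ∀ t z, A t < z.re → z.re < B t → F₁ t z = F₂ t z)
    {u : ℝ → ℂ} (hu : ∀ t, HasDerivAt u (F₁ t (u t)) t)
    (huA : ∀ t, A t < (u t).re) (huB : ∀ t, (u t).re < B t) :
    ∀ᶠ z in nhds (u 0), Φ₁ z T = Φ₂ z T := by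
  have huc : Continuous u := continuous_iff_continuousAt.mpr fun t => (hu t).continuousAt
  have hur : Continuous fun t => (u t).re := Complex.continuous_re.comp huc
  obtain ⟨ε, hε, hεA⟩ : ∃ ε > 0, ∀ t ∈ Icc 0 T, ε ≤ min ((u t).re - A t) (B t - (u t).re) := by
    have hcont : Continuous fun t => min ((u t).re - A t) (B t - (u t).re) := by fun_prop
    obtain ⟨t₀, _, ht₀⟩ := isCompact_Icc.exists_isMinOn (s := Icc (0 : ℝ) T) ⟨0, le_rfl, hT⟩
      hcont.continuousOn
    exact ⟨_, lt_min (sub_pos.mpr (huA t₀)) (sub_pos.mpr (huB t₀)), fun t ht => ht₀ ht⟩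
  have hpos : 0 < ε / Real.exp (K * T) := by positivity
  filter_upwards [Metric.ball_mem_nhds (u 0) hpos] with z hz
  rw [Metric.mem_ball, lt_div_iff₀ (Real.exp_pos _)] at hz
  have hin : ∀ t ∈ Icc 0 T, A t < (Φ₁ z t).re ∧ (Φ₁ z t).re < B t := by
    intro t ht
    have h3 := h₁.dist_le hK₁ z (u 0) ht.1
    rw [h₁.eq_of_sol hK₁ huc (fun t _ => hu t) t ht] at h3
    have h4 : Real.exp (K * t) ≤ Real.exp (K * T) := by
      apply Real.exp_le_exp.mpr
      exact mul_le_mul_of_nonneg_left ht.2 K.2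
    have h5 : dist z (u 0) * Real.exp (K * t) ≤ dist z (u 0) * Real.exp (K * T) :=
      mul_le_mul_of_nonneg_left h4 dist_nonneg
    have h6 : |(Φ₁ z t).re - (u t).re| < ε := by
      have := Complex.abs_re_le_norm (Φ₁ z t - u t)
      rw [Complex.sub_re, ← dist_eq_norm] at this
      linarith
    have h7 := hεA t ht
    rw [le_min_iff] at h7
    rw [abs_lt] at h6
    constructor <;> linarith [h6.1, h6.2, h7.1, h7.2]
  have h8 := h₂.eq_of_sol (T := T) hK₂ (u := Φ₁ z)
    (continuous_iff_continuousAt.mpr fun t => ((h₁ z).2 t).continuousAt)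
    (fun t ht => by
      rw [← hag t _ (hin t ht).1 (hin t ht).2]; exact (h₁ z).2 t) T ⟨hT, le_rfl⟩
  rw [(h₁ z).1] at h8
  exact h8.symm

/-- first order form of the pendulum equation -/
def Traj (c a b : ℝ) (p x y : ℝ → ℝ) : Prop :=
  (∀ t, HasDerivAt x (psi c (y t)) t) ∧
  ∀ t, HasDerivAt y (p t - a * psi c (y t) - b * Real.sin (x t)) t

lemma IsPendSol.traj {c a b T : ℝ} (hc : 0 < c) {p x : ℝ → ℝ} (h : IsPendSol c a b T p x) :
    Traj c a b p x (fun t => phi c (deriv x t)) := by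
  obtain ⟨_, h1, h2, h3, h4⟩ := h
  constructor
  · intro t
    rw [psi_phi hc (h2 t)]
    exact ((h1.differentiable one_ne_zero) t).hasDerivAt
  · intro t
    have := ((h3.differentiable one_ne_zero) t).hasDerivAt
    refine this.congr_deriv ?_
    rw [psi_phi hc (h2 t), ← h4 t]; ring

lemma Traj.pendSol {c a b T : ℝ} (hc : 0 < c) {p x y : ℝ → ℝ} (hp : Continuous p)
    (h : Traj c a b p x y) (hx : Function.Periodic x T) : IsPendSol c a b T p x := by
  obtain ⟨h1, h2⟩ := h
  have hd : deriv x = fun t => psi c (y t) := funext fun t => (h1 t).deriv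
  have hxc : Continuous x := continuous_iff_continuousAt.mpr fun t => (h1 t).continuousAt
  have hyc : Continuous y := continuous_iff_continuousAt.mpr fun t => (h2 t).continuousAt
  have hpsi := psi_continuous c
  have he : (fun t => phi c (deriv x t)) = y := by
    funext t; rw [hd]; exact phi_psi hc _
  have hdy : deriv y = fun t => p t - a * psi c (y t) - b * Real.sin (x t) :=
    funext fun t => (h2 t).deriv
  refine ⟨hx, ?_, ?_, ?_, ?_⟩
  · rw [contDiff_one_iff_deriv]
    refine ⟨fun t => (h1 t).differentiableAt, ?_⟩
    rw [hd]; exact hpsi.comp hyc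
  · intro t; rw [hd]; exact psi_abs_lt hc _
  · rw [he, contDiff_one_iff_deriv]
    refine ⟨fun t => (h2 t).differentiableAt, ?_⟩
    rw [hdy]; fun_prop
  · intro t
    rw [he, hdy, hd]; ring

lemma Traj.shift {c a b : ℝ} {p x y : ℝ → ℝ} (h : Traj c a b p x y) (k : ℤ) :
    Traj c a b p (fun t => x t + 2 * k * π) y := by
  refine ⟨fun t => (h.1 t).add_const _, fun t => ?_⟩
  have : Real.sin (x t + 2 * k * π) = Real.sin (x t) := by
    rw [show x t + 2 * k * π = x t + k * (2 * π) by ring, Real.sin_add_int_mul_two_pi]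
  simp only [this]
  exact h.2 t

/-- second order condition at a minimum of `x₁ - x₂` -/
lemma second_order {c : ℝ} {x₁ y₁ x₂ y₂ : ℝ → ℝ} {d₁ d₂ t₀ : ℝ}
    (h₁ : ∀ t, HasDerivAt x₁ (psi c (y₁ t)) t) (h₂ : ∀ t, HasDerivAt x₂ (psi c (y₂ t)) t)
    (hd₁ : HasDerivAt y₁ d₁ t₀) (hd₂ : HasDerivAt y₂ d₂ t₀)
    (hmin : ∀ t, x₁ t₀ - x₂ t₀ ≤ x₁ t - x₂ t) : y₁ t₀ = y₂ t₀ ∧ d₂ ≤ d₁ := by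
  have hD : ∀ t, HasDerivAt (fun t => x₁ t - x₂ t) (psi c (y₁ t) - psi c (y₂ t)) t :=
    fun t => (h₁ t).sub (h₂ t)
  have h0 : psi c (y₁ t₀) - psi c (y₂ t₀) = 0 := by
    apply IsLocalMin.hasDerivAt_eq_zero (f := fun t => x₁ t - x₂ t) (a := t₀) _ (hD t₀)
    exact Filter.Eventually.of_forall hmin
  have hy : y₁ t₀ = y₂ t₀ := (psi_strictMono c).injective (by linarith)
  refine ⟨hy, ?_⟩
  by_contra hlt
  push Not at hlt
  have hE : HasDerivAt (fun t => y₁ t - y₂ t) (d₁ - d₂) t₀ := hd₁.sub hd₂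
  have hneg : d₁ - d₂ < 0 := by linarith
  have hev : ∀ᶠ t in nhdsWithin t₀ (Ioi t₀), y₁ t - y₂ t < 0 := by
    have hs := (hasDerivAt_iff_tendsto_slope.mp hE)
    have hs' := hs.mono_left (nhdsWithin_mono t₀ (fun t (ht : t₀ < t) => ht.ne'))
    have := hs'.eventually (gt_mem_nhds hneg)
    filter_upwards [this, self_mem_nhdsWithin] with t ht htt
    rw [slope_def_field] at ht
    have htt' : (0 : ℝ) < t - t₀ := sub_pos.mpr htt
    rw [div_lt_iff₀ htt'] at ht
    simp only [hy, sub_self] at ht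
    linarith
  obtain ⟨t₁, ht₁, hI⟩ := (mem_nhdsGT_iff_exists_Ioc_subset).mp hev
  have hanti : StrictAntiOn (fun t => x₁ t - x₂ t) (Icc t₀ t₁) := by
    apply strictAntiOn_of_deriv_neg (convex_Icc _ _)
    · exact fun t _ => (hD t).continuousAt.continuousWithinAt
    · intro t ht
      rw [interior_Icc] at ht
      rw [(hD t).deriv]
      have : y₁ t - y₂ t < 0 := hI ⟨ht.1, ht.2.le⟩
      have := psi_strictMono c (show y₁ t < y₂ t by linarith)
      linarith
  have := hanti ⟨le_rfl, le_of_lt ht₁⟩ ⟨le_of_lt ht₁, le_rfl⟩ ht₁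
  have h2 := hmin t₁
  simp only at this
  linarith

lemma periodic_min {T : ℝ} (hT : 0 < T) {D : ℝ → ℝ} (hD : Continuous D)
    (hp : Function.Periodic D T) : ∃ t₀, ∀ t, D t₀ ≤ D t := by
  obtain ⟨t₀, _, h⟩ := isCompact_Icc.exists_isMinOn (s := Icc (0 : ℝ) T) ⟨0, le_rfl, hT.le⟩
      hD.continuousOn
  refine ⟨t₀, fun t => ?_⟩
  obtain ⟨s, hs, he⟩ := hp.exists_mem_Ico₀ hT t
  rw [he]
  exact h (Ico_subset_Icc_self hs)

lemma periodic_bdd {T : ℝ} (hT : 0 < T) {D : ℝ → ℝ} (hD : Continuous D)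
    (hp : Function.Periodic D T) : ∃ M, 0 ≤ M ∧ ∀ t, |D t| ≤ M := by
  obtain ⟨t₀, h⟩ := periodic_min hT (D := fun t => -|D t|) hD.abs.neg
    (fun t => by simp only [hp t])
  exact ⟨|D t₀|, abs_nonneg _, fun t => by linarith [h t]⟩

/-- truncation -/
noncomputable def gam (A B : ℝ → ℝ) (t x : ℝ) : ℝ := max (A t) (min (B t) x)

/-- the truncated vector field -/
noncomputable def fld (c a b C : ℝ) (p A B : ℝ → ℝ) (t : ℝ) (z : ℂ) : ℂ :=
  ⟨psi c z.im, p t - a * psi c z.im - b * Real.sin (gam A B t z.re)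
    + C * psi c (z.re - gam A B t z.re)⟩

lemma gam_dist (A B : ℝ → ℝ) (t x x' : ℝ) : |gam A B t x - gam A B t x'| ≤ |x - x'| := by
  unfold gam
  refine (abs_max_sub_max_le_max _ _ _ _).trans ?_
  rw [sub_self, abs_zero, max_eq_right (abs_nonneg _)]
  refine (abs_min_sub_min_le_max _ _ _ _).trans ?_
  rw [sub_self, abs_zero, max_eq_right (abs_nonneg _)]

lemma norm_le_re_im (z : ℂ) : ‖z‖ ≤ |z.re| + |z.im| := Complex.norm_le_abs_re_add_abs_im z

lemma fld_lipschitz {c a b C : ℝ} (ha : 0 < a) (hb : 0 < b) (hC : 0 < C) (p A B : ℝ → ℝ) (t : ℝ) :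
    LipschitzWith (Real.toNNReal (1 + a + b + 2 * C)) (fld c a b C p A B t) := by
  apply LipschitzWith.of_dist_le_mul
  intro z w
  rw [Real.coe_toNNReal _ (by positivity), dist_eq_norm, dist_eq_norm]
  refine (norm_le_re_im _).trans ?_
  have h1 : |z.im - w.im| ≤ ‖z - w‖ := by
    simpa using Complex.abs_im_le_norm (z - w)
  have h2 : |z.re - w.re| ≤ ‖z - w‖ := by
    simpa using Complex.abs_re_le_norm (z - w)
  have h3 := psi_dist c z.im w.im
  have h4 := gam_dist A B t z.re w.re
  have h5 := psi_dist c (z.re - gam A B t z.re) (w.re - gam A B t w.re)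
  have h6 : |(z.re - gam A B t z.re) - (w.re - gam A B t w.re)| ≤ 2 * ‖z - w‖ := by
    rw [show (z.re - gam A B t z.re) - (w.re - gam A B t w.re)
      = (z.re - w.re) - (gam A B t z.re - gam A B t w.re) by ring]
    refine (abs_sub _ _).trans ?_
    linarith
  have h7 : |Real.sin (gam A B t z.re) - Real.sin (gam A B t w.re)| ≤ ‖z - w‖ :=
    ((Real.abs_sin_sub_sin_le _ _).trans h4).trans h2
  have hre : (fld c a b C p A B t z - fld c a b C p A B t w).re = psi c z.im - psi c w.im := by
    simp [fld]
  have him : (fld c a b C p A B t z - fld c a b C p A B t w).im =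
      -(a * (psi c z.im - psi c w.im)) -
      b * (Real.sin (gam A B t z.re) - Real.sin (gam A B t w.re)) +
      C * (psi c (z.re - gam A B t z.re) - psi c (w.re - gam A B t w.re)) := by
    simp [fld]; ring
  rw [hre, him]
  have h8 : |psi c z.im - psi c w.im| ≤ ‖z - w‖ := h3.trans h1
  have h9 := h5.trans h6
  generalize ‖z - w‖ = n at *
  generalize psi c z.im - psi c w.im = q1 at *
  generalize Real.sin (gam A B t z.re) - Real.sin (gam A B t w.re) = q2 at *
  generalize psi c (z.re - gam A B t z.re) - psi c (w.re - gam A B t w.re) = q3 at *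
  have e1 : |-(a * q1) - b * q2 + C * q3| ≤ a * |q1| + b * |q2| + C * |q3| := by
    calc |-(a * q1) - b * q2 + C * q3| ≤ |-(a * q1) - b * q2| + |C * q3| := abs_add_le _ _
      _ ≤ |-(a * q1)| + |b * q2| + |C * q3| := by gcongr; exact abs_sub _ _
      _ = _ := by rw [abs_neg, abs_mul, abs_mul, abs_mul, abs_of_pos ha, abs_of_pos hb, abs_of_pos hC]
  have e2 := mul_le_mul_of_nonneg_left h8 ha.le
  have e3 := mul_le_mul_of_nonneg_left h7 hb.le
  have e4 := mul_le_mul_of_nonneg_left h9 hC.le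
  linarith

lemma fld_continuous {c a b C : ℝ} {p A B : ℝ → ℝ} (hp : Continuous p) (hA : Continuous A)
    (hB : Continuous B) (z : ℂ) : Continuous fun t => fld c a b C p A B t z := by
  have hpsi := psi_continuous c
  have h : ∀ t, fld c a b C p A B t z = (psi c z.im : ℂ) +
    ((p t - a * psi c z.im - b * Real.sin (gam A B t z.re)
    + C * psi c (z.re - gam A B t z.re) : ℝ) : ℂ) * Complex.I := by
    intro t
    exact (Complex.re_add_im (fld c a b C p A B t z)).symm
  simp only [h]
  have hg : Continuous fun t => gam A B t z.re := by unfold gam; fun_prop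
  have : Continuous fun t => (p t - a * psi c z.im - b * Real.sin (gam A B t z.re)
    + C * psi c (z.re - gam A B t z.re) : ℝ) := by fun_prop
  exact continuous_const.add ((Complex.continuous_ofReal.comp this).mul continuous_const)

lemma fld_im_base {c a b P : ℝ} (hc : 0 < c) (ha : 0 < a) (hb : 0 < b) {p : ℝ → ℝ}
    (hP : ∀ t, |p t| ≤ P) (t y g : ℝ) : |p t - a * psi c y - b * Real.sin g| ≤ P + a * c + b := by
  have h1 := mul_le_mul_of_nonneg_left (psi_abs_lt hc y).le ha.le
  have h2 := mul_le_mul_of_nonneg_left (Real.abs_sin_le_one g) hb.le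
  calc |p t - a * psi c y - b * Real.sin g| ≤ |p t - a * psi c y| + |b * Real.sin g| := abs_sub _ _
    _ ≤ |p t| + |a * psi c y| + |b * Real.sin g| := by gcongr; exact abs_sub _ _
    _ ≤ _ := by rw [abs_mul, abs_mul, abs_of_pos ha, abs_of_pos hb]; linarith [hP t]

lemma fld_im_le {c a b C P : ℝ} (hc : 0 < c) (ha : 0 < a) (hb : 0 < b) (hC : 0 < C) {p A B : ℝ → ℝ}
    (hP : ∀ t, |p t| ≤ P) (t : ℝ) (z : ℂ) :
    |(fld c a b C p A B t z).im| ≤ P + a * c + b + C * c := by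
  have h1 := fld_im_base hc ha hb hP t z.im (gam A B t z.re)
  have h2 := mul_le_mul_of_nonneg_left (psi_abs_lt hc (z.re - gam A B t z.re)).le hC.le
  simp only [fld]
  refine (abs_add_le _ _).trans ?_
  rw [abs_mul, abs_of_pos hC]
  linarith

lemma fld_bound {c a b C P : ℝ} (hc : 0 < c) (ha : 0 < a) (hb : 0 < b) (hC : 0 < C) {p A B : ℝ → ℝ}
    (hP : ∀ t, |p t| ≤ P) (t : ℝ) (z : ℂ) :
    ‖fld c a b C p A B t z‖ ≤ c + (P + a * c + b + C * c) := by
  have h1 := fld_im_le (A := A) (B := B) hc ha hb hC hP t z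
  have h2 : |(fld c a b C p A B t z).re| ≤ c := (psi_abs_lt hc _).le
  linarith [norm_le_re_im (fld c a b C p A B t z)]

lemma psi_mul_ge {c : ℝ} (hc : 0 < c) {y : ℝ} (hy : c ≤ |y|) : |y| * (c / 2) ≤ y * psi c y := by
  have hm := (psi_strictMono c).monotone
  have h := psi_c_ge hc
  rcases le_abs'.mp hy with h1 | h1
  · have h2 := hm h1
    rw [psi_neg] at h2
    rw [abs_of_neg (by linarith)]
    nlinarith
  · have h2 := hm h1
    rw [abs_of_pos (by linarith)]
    nlinarith

lemma psi_mul_nonneg {c : ℝ} (y : ℝ) : 0 ≤ y * psi c y := by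
  have hm := (psi_strictMono c).monotone
  rcases le_total 0 y with h | h
  · have := hm h
    rw [psi_zero] at this
    positivity
  · have := hm h
    rw [psi_zero] at this
    exact mul_nonneg_of_nonpos_of_nonpos h this

lemma far_pt {c a b C P M : ℝ} (hc : 0 < c) (ha : 0 < a) (hb : 0 < b) (hC : 0 < C)
    {p A B : ℝ → ℝ} (hP0 : 0 ≤ P) (hM0 : 0 ≤ M)
    (hP : ∀ t, |p t| ≤ P) (hCc : P + a * c + b + 1 ≤ C * (c / 2))
    (hA : ∀ t, |A t| ≤ M) (hB : ∀ t, |B t| ≤ M) (t : ℝ) (z : ℂ)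
    (hz : M + c + (c + 2 * ((M + c) * (P + a * c + b + C * c)) / c) ≤ ‖z‖) :
    0 < z.im * psi c z.im + z.re * (fld c a b C p A B t z).im := by
  have hm := (psi_strictMono c).monotone
  have hpc := psi_c_ge hc
  have hbase := abs_le.mp (fld_im_base hc ha hb hP t z.im (gam A B t z.re))
  have him : (fld c a b C p A B t z).im = (p t - a * psi c z.im - b * Real.sin (gam A B t z.re))
    + C * psi c (z.re - gam A B t z.re) := rfl
  have hA' := abs_le.mp (hA t)
  have hB' := abs_le.mp (hB t)
  have hn := psi_mul_nonneg (c := c) z.im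
  by_cases h1 : M + c ≤ |z.re|
  · rcases le_abs'.mp h1 with h2 | h2
    · have hg : -M ≤ gam A B t z.re := le_max_of_le_left hA'.1
      have h3 : psi c (z.re - gam A B t z.re) ≤ psi c (-c) := hm (by linarith)
      rw [psi_neg] at h3
      have h4 : C * psi c (z.re - gam A B t z.re) ≤ C * (-(c / 2)) :=
        mul_le_mul_of_nonneg_left (by linarith) hC.le
      have h5 : (fld c a b C p A B t z).im ≤ -1 := by rw [him]; linarith [hbase.2]
      nlinarith
    · have hg : gam A B t z.re ≤ M := max_le hA'.2 (min_le_of_left_le hB'.2)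
      have h3 : psi c c ≤ psi c (z.re - gam A B t z.re) := hm (by linarith)
      have h4 : C * (c / 2) ≤ C * psi c (z.re - gam A B t z.re) :=
        mul_le_mul_of_nonneg_left (by linarith) hC.le
      have h5 : 1 ≤ (fld c a b C p A B t z).im := by rw [him]; linarith [hbase.1]
      nlinarith
  · push Not at h1
    set G := P + a * c + b + C * c with hG
    have hG0 : 0 ≤ G := by positivity
    have hy : c + 2 * ((M + c) * G) / c ≤ |z.im| := by linarith [norm_le_re_im z]
    have h0 : 0 ≤ 2 * ((M + c) * G) / c := by positivity
    have h2 := psi_mul_ge hc (y := z.im) (by linarith)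
    have h3 : (c + 2 * ((M + c) * G) / c) * (c / 2) ≤ |z.im| * (c / 2) :=
      mul_le_mul_of_nonneg_right hy (by positivity)
    have h4 : (c + 2 * ((M + c) * G) / c) * (c / 2) = c ^ 2 / 2 + (M + c) * G := by
      field_simp
    have h5 : |z.re * (fld c a b C p A B t z).im| ≤ (M + c) * G := by
      rw [abs_mul]
      exact mul_le_mul h1.le (fld_im_le hc ha hb hC hP t z) (abs_nonneg _) (by positivity)
    have h6 := (abs_le.mp h5).1
    have : 0 < c ^ 2 := by positivity
    linarith

lemma hasDerivAt_re {u : ℝ → ℂ} {d : ℂ} {t : ℝ} (h : HasDerivAt u d t) :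
    HasDerivAt (fun t => (u t).re) d.re t := by
  have := (Complex.reCLM.hasFDerivAt (x := u t)).comp_hasDerivAt t h
  exact this

lemma hasDerivAt_im {u : ℝ → ℂ} {d : ℂ} {t : ℝ} (h : HasDerivAt u d t) :
    HasDerivAt (fun t => (u t).im) d.im t := by
  have := (Complex.imCLM.hasFDerivAt (x := u t)).comp_hasDerivAt t h
  exact this

lemma far_field {c a b C P M T : ℝ} (hc : 0 < c) (ha : 0 < a) (hb : 0 < b) (hC : 0 < C)
    (hT : 0 < T) {p A B : ℝ → ℝ} (hP0 : 0 ≤ P) (hM0 : 0 ≤ M)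
    (hP : ∀ t, |p t| ≤ P) (hCc : P + a * c + b + 1 ≤ C * (c / 2))
    (hA : ∀ t, |A t| ≤ M) (hB : ∀ t, |B t| ≤ M) {Φ : ℂ → ℝ → ℂ}
    (hΦ : IsFlow (fld c a b C p A B) Φ) :
    ∃ ρ > 0, ∀ z : ℂ, ρ ≤ ‖z‖ →
      (Φ z T - z) / (Complex.I * (starRingEnd ℂ) z) ∈ Complex.slitPlane := by
  set R := M + c + (c + 2 * ((M + c) * (P + a * c + b + C * c)) / c) with hR
  set L := c + (P + a * c + b + C * c) with hL
  have hR0 : 0 < R := by positivity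
  have hL0 : 0 < L := by positivity
  refine ⟨R + L * T, by positivity, fun z hz => ?_⟩
  have hdist : ∀ t ∈ Icc 0 T, ‖Φ z t - z‖ ≤ L * T := by
    intro t ht
    have h := (convex_univ (𝕜 := ℝ) (E := ℝ)).norm_image_sub_le_of_norm_hasDerivWithin_le
      (f := Φ z) (f' := fun t => fld c a b C p A B t (Φ z t)) (C := L) (x := 0) (y := t)
      (fun t _ => ((hΦ z).2 t).hasDerivWithinAt)
      (fun t _ => fld_bound hc ha hb hC hP t _) (mem_univ _) (mem_univ _)
    rw [(hΦ z).1, sub_zero, Real.norm_eq_abs, abs_of_nonneg ht.1] at h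
    exact h.trans (mul_le_mul_of_nonneg_left ht.2 hL0.le)
  have hbig : ∀ t ∈ Icc 0 T, R ≤ ‖Φ z t‖ := by
    intro t ht
    have h1 := hdist t ht
    have h2 := norm_sub_norm_le z (Φ z t)
    rw [norm_sub_rev] at h2
    linarith
  have hder : ∀ t, HasDerivAt (fun t => (Φ z t).re * (Φ z t).im)
      ((Φ z t).im * psi c (Φ z t).im + (Φ z t).re * (fld c a b C p A B t (Φ z t)).im) t := by
    intro t
    have h1 := hasDerivAt_re ((hΦ z).2 t)
    have h2 := hasDerivAt_im ((hΦ z).2 t)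
    refine (h1.mul h2).congr_deriv ?_
    have : (fld c a b C p A B t (Φ z t)).re = psi c (Φ z t).im := rfl
    rw [this]; ring
  have hmono : StrictMonoOn (fun t => (Φ z t).re * (Φ z t).im) (Icc 0 T) := by
    apply strictMonoOn_of_deriv_pos (convex_Icc _ _)
    · exact fun t _ => (hder t).continuousAt.continuousWithinAt
    · intro t ht
      rw [interior_Icc] at ht
      rw [(hder t).deriv]
      exact far_pt hc ha hb hC hP0 hM0 hP hCc hA hB t _ (hbig t (Ioo_subset_Icc_self ht))
  have hlt := hmono ⟨le_rfl, hT.le⟩ ⟨hT.le, le_rfl⟩ hT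
  simp only [(hΦ z).1] at hlt
  have hV := hdist T ⟨hT.le, le_rfl⟩
  by_contra hns
  rw [Complex.mem_slitPlane_iff] at hns
  push Not at hns
  set q := (Φ z T - z) / (Complex.I * (starRingEnd ℂ) z) with hq
  have hz0 : 0 < ‖z‖ := lt_of_lt_of_le (by positivity) hz
  have hzne : z ≠ 0 := norm_pos_iff.mp hz0
  have hNne : Complex.I * (starRingEnd ℂ) z ≠ 0 := by simp [hzne]
  have hqe : Φ z T - z = q * (Complex.I * (starRingEnd ℂ) z) := by
    rw [hq, div_mul_cancel₀ _ hNne]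
  have hqk : q = ((q.re : ℝ) : ℂ) := by
    apply Complex.ext <;> simp [hns.2]
  set k := -q.re with hk
  have hk0 : 0 ≤ k := by linarith [hns.1]
  have hqk' : q = ((-k : ℝ) : ℂ) := by rw [hqk]; simp [hk]
  have hkn : k * ‖z‖ ≤ L * T := by
    rw [hqe, hqk', norm_mul, norm_mul, Complex.norm_I, RCLike.norm_conj, one_mul,
      Complex.norm_real, Real.norm_eq_abs, abs_neg, abs_of_nonneg hk0] at hV
    exact hV
  have hk1 : k ≤ 1 := by
    by_contra h
    push Not at h
    nlinarith [mul_pos hL0 hT]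
  have hx : (Φ z T).re = z.re - k * z.im := by
    have := congrArg Complex.re hqe
    rw [hqk'] at this
    simp at this
    linarith
  have hy : (Φ z T).im = z.im - k * z.re := by
    have := congrArg Complex.im hqe
    rw [hqk'] at this
    simp at this
    linarith
  rw [hx, hy] at hlt
  have : 0 ≤ k * (1 - k) * (z.re ^ 2 + z.im ^ 2) :=
    mul_nonneg (mul_nonneg hk0 (by linarith)) (by positivity)
  nlinarith [mul_nonneg (mul_nonneg hk0 hk0) (sq_nonneg (z.re - z.im)),
    mul_nonneg hk0 (sq_nonneg (z.re)), mul_nonneg hk0 (sq_nonneg (z.im)), mul_nonneg (mul_nonneg hk0 hk0) (sq_nonneg (z.re)), mul_nonneg (mul_nonneg hk0 hk0) (sq_nonneg (z.im))]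

/-- a fixed point of the truncated Poincaré map is a solution strictly between the barriers -/
lemma fixed_sol {c a b C T δ δ' : ℝ} (ha : 0 < a) (hb : 0 < b) (hC : 0 < C)
    (hT : 0 < T) {p A B yA yB : ℝ → ℝ} (hp : Function.Periodic p T)
    (hδ : 0 < δ) (hδ' : 0 < δ')
    (hA : Traj c a b (fun t => p t + δ) A yA) (hB : Traj c a b (fun t => p t - δ') B yB)
    (hAp : Function.Periodic A T) (hBp : Function.Periodic B T) (hAB : ∀ t, A t ≤ B t)
    {Φ : ℂ → ℝ → ℂ} (hΦ : IsFlow (fld c a b C p A B) Φ) {z : ℂ} (hz : Φ z T = z) :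
    Function.Periodic (fun t => (Φ z t).re) T ∧
    (∀ t, A t < (Φ z t).re) ∧ (∀ t, (Φ z t).re < B t) ∧
    Traj c a b p (fun t => (Φ z t).re) (fun t => (Φ z t).im) := by
  have hper : Function.Periodic (Φ z) T := by
    refine hΦ.periodic (fld_lipschitz ha hb hC p A B) (fun t w => ?_) hz
    simp only [fld, gam, hp t, hAp t, hBp t]
  have hrp : Function.Periodic (fun t => (Φ z t).re) T := fun t => by simp only [hper t]
  have hx : ∀ t, HasDerivAt (fun t => (Φ z t).re) (psi c (Φ z t).im) t :=
    fun t => hasDerivAt_re ((hΦ z).2 t)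
  have hy : ∀ t, HasDerivAt (fun t => (Φ z t).im) (fld c a b C p A B t (Φ z t)).im t :=
    fun t => hasDerivAt_im ((hΦ z).2 t)
  have hxc : Continuous fun t => (Φ z t).re :=
    continuous_iff_continuousAt.mpr fun t => (hx t).continuousAt
  have hAc : Continuous A := continuous_iff_continuousAt.mpr fun t => (hA.1 t).continuousAt
  have hBc : Continuous B := continuous_iff_continuousAt.mpr fun t => (hB.1 t).continuousAt
  have hm := (psi_strictMono c).monotone
  have hlow : ∀ t, A t < (Φ z t).re := by
    obtain ⟨t₀, h0⟩ := periodic_min hT (D := fun t => (Φ z t).re - A t) (hxc.sub hAc)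
      (fun t => by simp only [hper t, hAp t])
    by_contra hcon
    push Not at hcon
    obtain ⟨t₁, ht₁⟩ := hcon
    have hle : (Φ z t₀).re ≤ A t₀ := by linarith [h0 t₁]
    obtain ⟨e1, e2⟩ := second_order hx hA.1 (hy t₀) (hA.2 t₀) h0
    have hg : gam A B t₀ (Φ z t₀).re = A t₀ := max_eq_left (min_le_of_right_le hle)
    have e3 : psi c ((Φ z t₀).re - A t₀) ≤ 0 := by
      rw [← psi_zero c]; exact hm (by linarith)
    simp only [fld, hg, e1] at e2
    nlinarith
  have hup : ∀ t, (Φ z t).re < B t := by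
    obtain ⟨t₀, h0⟩ := periodic_min hT (D := fun t => B t - (Φ z t).re) (hBc.sub hxc)
      (fun t => by simp only [hper t, hBp t])
    by_contra hcon
    push Not at hcon
    obtain ⟨t₁, ht₁⟩ := hcon
    have hle : B t₀ ≤ (Φ z t₀).re := by linarith [h0 t₁]
    obtain ⟨e1, e2⟩ := second_order hB.1 hx (hB.2 t₀) (hy t₀) h0
    have hg : gam A B t₀ (Φ z t₀).re = B t₀ := by
      unfold gam; rw [min_eq_left hle, max_eq_right (hAB t₀)]
    have e3 : 0 ≤ psi c ((Φ z t₀).re - B t₀) := by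
      rw [← psi_zero c]; exact hm (by linarith)
    simp only [fld, hg, ← e1] at e2
    nlinarith
  refine ⟨hrp, hlow, hup, hx, fun t => ?_⟩
  refine (hy t).congr_deriv ?_
  have hg : gam A B t (Φ z t).re = (Φ z t).re := by
    unfold gam; rw [min_eq_right (hup t).le, max_eq_right (hlow t).le]
  simp only [fld, hg, sub_self, psi_zero]
  ring

lemma slit_exp {V : ℂ → ℂ} (hV : Continuous V) {ρ : ℝ} (hρ : 0 < ρ)
    (h : ∀ z : ℂ, ρ ≤ ‖z‖ → V z / (Complex.I * (starRingEnd ℂ) z) ∈ Complex.slitPlane) {r : ℝ}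
    (hr : ρ ≤ r) : ∃ g : ℂ → ℂ, ContinuousOn g {z | ‖z‖ = r} ∧
      ∀ z : ℂ, ‖z‖ = r → V z = (starRingEnd ℂ) z * Complex.exp (g z) := by
  refine ⟨fun z => Complex.log (V z / (Complex.I * (starRingEnd ℂ) z)) + Complex.log Complex.I, ?_, ?_⟩
  · refine ContinuousOn.add ?_ continuousOn_const
    refine ContinuousOn.clog ?_ (fun z hz => h z (by rw [hz]; exact hr))
    refine hV.continuousOn.div ?_ ?_
    · exact (continuous_const.mul Complex.continuous_conj).continuousOn
    · intro z hz
      have : z ≠ 0 := by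
        rintro rfl
        simp at hz; linarith
      simp [this]
  · intro z hz
    have hz0 : z ≠ 0 := by
      rintro rfl
      simp at hz; linarith
    have hs := h z (by rw [hz]; exact hr)
    have hne := Complex.slitPlane_ne_zero hs
    rw [Complex.exp_add, Complex.exp_log hne, Complex.exp_log Complex.I_ne_zero]
    have h1 : (starRingEnd ℂ) z ≠ 0 := by simp [hz0]
    have h2 := Complex.I_ne_zero
    field_simp

lemma zero_exists {V : ℂ → ℂ} (hV : Continuous V) {ρ : ℝ} (hρ : 0 < ρ)
    (h : ∀ z : ℂ, ρ ≤ ‖z‖ → V z / (Complex.I * (starRingEnd ℂ) z) ∈ Complex.slitPlane) :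
    ∃ z, V z = 0 := by
  by_contra hcon
  push Not at hcon
  obtain ⟨g, hg, hge⟩ := slit_exp hV hρ h le_rfl
  exact no_ext V g ρ hρ hV hcon hg hge

lemma triple {V₁ V₂ V₃ : ℂ → ℂ} (hV₁ : Continuous V₁) (hV₂ : Continuous V₂) (hV₃ : Continuous V₃)
    (h₁ : ∃ ρ > 0, ∀ z : ℂ, ρ ≤ ‖z‖ → V₁ z / (Complex.I * (starRingEnd ℂ) z) ∈ Complex.slitPlane)
    (h₂ : ∃ ρ > 0, ∀ z : ℂ, ρ ≤ ‖z‖ → V₂ z / (Complex.I * (starRingEnd ℂ) z) ∈ Complex.slitPlane)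
    (h₃ : ∃ ρ > 0, ∀ z : ℂ, ρ ≤ ‖z‖ → V₃ z / (Complex.I * (starRingEnd ℂ) z) ∈ Complex.slitPlane)
    {z₁ z₃ : ℂ} (hne : z₁ ≠ z₃) (hz₁ : ∀ z, V₁ z = 0 → z = z₁) (hz₃ : ∀ z, V₃ z = 0 → z = z₃)
    (hz₂ : ∀ z, V₂ z = 0 → z = z₁ ∨ z = z₃) (e₁ : ∀ᶠ z in nhds z₁, V₁ z = V₂ z)
    (e₃ : ∀ᶠ z in nhds z₃, V₃ z = V₂ z) : False := by
  obtain ⟨ρ₁, hρ₁, h₁⟩ := h₁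
  obtain ⟨ρ₂, hρ₂, h₂⟩ := h₂
  obtain ⟨ρ₃, hρ₃, h₃⟩ := h₃
  set r := ρ₁ + ρ₂ + ρ₃ + ‖z₁‖ + ‖z₃‖ with hr
  have n1 := norm_nonneg z₁
  have n3 := norm_nonneg z₃
  obtain ⟨g₁, hg₁, hge₁⟩ := slit_exp hV₁ hρ₁ h₁ (r := r) (by linarith)
  obtain ⟨g₂, hg₂, hge₂⟩ := slit_exp hV₂ hρ₂ h₂ (r := r) (by linarith)
  obtain ⟨g₃, hg₃, hge₃⟩ := slit_exp hV₃ hρ₃ h₃ (r := r) (by linarith)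
  classical
  let f : ℂ → ℂ := fun z => if z = z₁ then V₃ z else if z = z₃ then V₁ z else V₁ z * V₃ z / V₂ z
  have hf0 : ∀ z, f z ≠ 0 := by
    intro z
    by_cases c1 : z = z₁
    · simp only [f, if_pos c1]
      intro h
      exact hne (c1 ▸ hz₃ z h)
    by_cases c3 : z = z₃
    · simp only [f, if_neg c1, if_pos c3]
      intro h
      exact c1 (hz₁ z h)
    simp only [f, if_neg c1, if_neg c3]
    exact div_ne_zero (mul_ne_zero (fun h => c1 (hz₁ z h)) (fun h => c3 (hz₃ z h)))
      (fun h => (hz₂ z h).elim c1 c3)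
  have hfc : Continuous f := by
    rw [continuous_iff_continuousAt]
    intro w
    by_cases c1 : w = z₁
    · subst c1
      have : f =ᶠ[nhds w] V₃ := by
        filter_upwards [e₁, isOpen_ne.mem_nhds hne] with z hz hz3
        by_cases c1 : z = w
        · simp only [f, if_pos c1]
        · simp only [f, if_neg c1, if_neg hz3, ← hz]
          have : V₁ z ≠ 0 := fun h => c1 (hz₁ z h)
          field_simp
      exact hV₃.continuousAt.congr this.symm
    by_cases c3 : w = z₃
    · subst c3
      have : f =ᶠ[nhds w] V₁ := by
        filter_upwards [e₃, isOpen_ne.mem_nhds hne.symm] with z hz hz3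
        by_cases c1 : z = w
        · simp only [f, if_neg hz3, if_pos c1]
        · simp only [f, if_neg c1, if_neg hz3, ← hz]
          have : V₃ z ≠ 0 := fun h => c1 (hz₃ z h)
          field_simp
      exact hV₁.continuousAt.congr this.symm
    have : f =ᶠ[nhds w] fun z => V₁ z * V₃ z / V₂ z := by
      filter_upwards [isOpen_ne.mem_nhds c1, isOpen_ne.mem_nhds c3] with z q1 q3
      simp only [f, if_neg q1, if_neg q3]
    refine ContinuousAt.congr ?_ this.symm
    exact (hV₁.continuousAt.mul hV₃.continuousAt).div hV₂.continuousAt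
      (fun h => (hz₂ w h).elim c1 c3)
  refine no_ext f (fun z => g₁ z + g₃ z - g₂ z) r (by linarith) hfc hf0 ((hg₁.add hg₃).sub hg₂) ?_
  intro z hz
  have c1 : z ≠ z₁ := by rintro rfl; linarith
  have c3 : z ≠ z₃ := by rintro rfl; linarith
  have hz0 : z ≠ 0 := by
    rintro rfl
    simp at hz; linarith
  have h1 : (starRingEnd ℂ) z ≠ 0 := by simp [hz0]
  simp only [f, if_neg c1, if_neg c3]
  rw [hge₁ z hz, hge₂ z hz, hge₃ z hz, Complex.exp_sub, Complex.exp_add]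
  have := Complex.exp_ne_zero (g₂ z)
  field_simp

lemma Traj.continuous {c a b : ℝ} {p x y : ℝ → ℝ} (h : Traj c a b p x y) : Continuous x :=
  continuous_iff_continuousAt.mpr fun t => (h.1 t).continuousAt

lemma fld_sol {c a b C : ℝ} {p A B x y : ℝ → ℝ} (h : Traj c a b p x y)
    (hA : ∀ t, A t < x t) (hB : ∀ t, x t < B t) (t : ℝ) :
    HasDerivAt (fun t => (⟨x t, y t⟩ : ℂ)) (fld c a b C p A B t ⟨x t, y t⟩) t := by
  have h1 := ((h.1 t).ofReal_comp).add (((h.2 t).ofReal_comp).mul_const Complex.I)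
  have e : (fun t => (⟨x t, y t⟩ : ℂ)) = (fun t => (x t : ℂ) + (y t : ℂ) * Complex.I) := by
    funext t; exact Complex.mk_eq_add_mul_I _ _
  rw [e]
  refine h1.congr_deriv ?_
  have hg : gam A B t (x t) = x t := by
    unfold gam; rw [min_eq_right (hB t).le, max_eq_right (hA t).le]
  simp only [fld, hg, sub_self, psi_zero, Complex.mk_eq_add_mul_I]
  push_cast
  ring

lemma fld_agree {c a b C : ℝ} {p A B A' B' : ℝ → ℝ} (t : ℝ) (z : ℂ) (h1 : A t < z.re)
    (h2 : z.re < B t) (h3 : A' t < z.re) (h4 : z.re < B' t) :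
    fld c a b C p A B t z = fld c a b C p A' B' t z := by
  have hg : gam A B t z.re = z.re := by
    unfold gam; rw [min_eq_right h2.le, max_eq_right h1.le]
  have hg' : gam A' B' t z.re = z.re := by
    unfold gam; rw [min_eq_right h4.le, max_eq_right h3.le]
  simp only [fld, hg, hg']

lemma package {c a b C P T δ δ' : ℝ} (hc : 0 < c) (ha : 0 < a) (hb : 0 < b) (hC : 0 < C)
    (hT : 0 < T) {p A B yA yB : ℝ → ℝ} (hpc : Continuous p) (hp : Function.Periodic p T)
    (hP0 : 0 ≤ P) (hP : ∀ t, |p t| ≤ P) (hCc : P + a * c + b + 1 ≤ C * (c / 2))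
    (hδ : 0 < δ) (hδ' : 0 < δ')
    (hA : Traj c a b (fun t => p t + δ) A yA) (hB : Traj c a b (fun t => p t - δ') B yB)
    (hAp : Function.Periodic A T) (hBp : Function.Periodic B T) (hAB : ∀ t, A t ≤ B t) :
    ∃ Φ : ℂ → ℝ → ℂ, IsFlow (fld c a b C p A B) Φ ∧ (Continuous fun z => Φ z T - z) ∧
      (∃ ρ > 0, ∀ z : ℂ, ρ ≤ ‖z‖ →
        (Φ z T - z) / (Complex.I * (starRingEnd ℂ) z) ∈ Complex.slitPlane) ∧
      (∀ z, Φ z T - z = 0 → ∃ x y : ℝ → ℝ, Function.Periodic x T ∧ (∀ t, A t < x t) ∧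
        (∀ t, x t < B t) ∧ Traj c a b p x y ∧ z = ⟨x 0, y 0⟩) := by
  have hAc := hA.continuous
  have hBc := hB.continuous
  have hK := fld_lipschitz (c := c) ha hb hC p A B
  obtain ⟨Φ, hΦ⟩ := exists_flow (fld c a b C p A B) _
    (Real.toNNReal (c + (P + a * c + b + C * c))) hK (fld_continuous hpc hAc hBc)
    (fun t z => by
      rw [Real.coe_toNNReal _ (by positivity)]
      exact fld_bound hc ha hb hC hP t z)
  obtain ⟨M1, hM1, hM1'⟩ := periodic_bdd hT hAc hAp
  obtain ⟨M2, hM2, hM2'⟩ := periodic_bdd hT hBc hBp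
  refine ⟨Φ, hΦ, (hΦ.continuous_time hK hT.le).sub continuous_id, ?_, ?_⟩
  · exact far_field (M := M1 + M2) hc ha hb hC hT hP0 (by linarith) hP hCc
      (fun t => by linarith [hM1' t]) (fun t => by linarith [hM2' t]) hΦ
  · intro z hz
    obtain ⟨q1, q2, q3, q4⟩ := fixed_sol ha hb hC hT hp hδ hδ' hA hB hAp hBp hAB hΦ
      (sub_eq_zero.mp hz)
    exact ⟨_, _, q1, q2, q3, q4, by simp [(hΦ z).1]⟩

lemma Traj.y_unique {c a b : ℝ} {p x y x' y' : ℝ → ℝ} (h : Traj c a b p x y)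
    (h' : Traj c a b p x' y') {d : ℝ} (hx : ∀ t, x t = x' t + d) (t : ℝ) : y t = y' t := by
  have e : x = fun t => x' t + d := funext hx
  have h1 := h.1 t
  rw [e] at h1
  exact (psi_strictMono c).injective (h1.unique ((h'.1 t).add_const d))

lemma shift_periodic {x : ℝ → ℝ} {T d : ℝ} (h : Function.Periodic x T) :
    Function.Periodic (fun t => x t + d) T := fun t => by simp only [h t]

lemma core {c a b T δ δ' : ℝ} (hc : 0 < c) (ha : 0 < a) (hb : 0 < b)
    (hT : 0 < T) {p A B₀ yA yB : ℝ → ℝ} (hpc : Continuous p) (hp : Function.Periodic p T)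
    (hδ : 0 < δ) (hδ' : 0 < δ')
    (hA : Traj c a b (fun t => p t + δ) A yA) (hB₀ : Traj c a b (fun t => p t - δ') B₀ yB)
    (hAp : Function.Periodic A T) (hB₀p : Function.Periodic B₀ T)
    (huniq : ∀ x₁ x₂ : ℝ → ℝ, IsPendSol c a b T p x₁ → IsPendSol c a b T p x₂ →
      ∃ k : ℤ, ∀ t, x₁ t = x₂ t + 2 * (k : ℝ) * π) : False := by
  obtain ⟨P, hP0, hP⟩ := periodic_bdd hT hpc hp
  obtain ⟨MA, hMA, hMA'⟩ := periodic_bdd hT hA.continuous hAp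
  obtain ⟨MB, hMB, hMB'⟩ := periodic_bdd hT hB₀.continuous hB₀p
  obtain ⟨C, hC, hCc⟩ : ∃ C > 0, P + a * c + b + 1 ≤ C * (c / 2) :=
    ⟨2 * (P + a * c + b + 1) / c, by positivity, le_of_eq (by field_simp)⟩
  have hpi : 0 < π := Real.pi_pos
  -- large shifts
  have hlarge : ∀ M : ℝ, ∃ j : ℤ, M < 2 * (j : ℝ) * π := by
    intro M
    obtain ⟨j, hj⟩ := exists_int_gt (M / (2 * π))
    refine ⟨j, ?_⟩
    rw [div_lt_iff₀ (by positivity)] at hj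
    linarith
  have hmono : ∀ {i j : ℤ}, i ≤ j → 2 * (i : ℝ) * π ≤ 2 * (j : ℝ) * π := by
    intro i j hij
    have : (i : ℝ) ≤ j := by exact_mod_cast hij
    nlinarith
  -- existence of one solution
  obtain ⟨x₀, y₀, hx₀p, hx₀⟩ : ∃ x₀ y₀ : ℝ → ℝ, Function.Periodic x₀ T ∧ Traj c a b p x₀ y₀ := by
    obtain ⟨j, hj⟩ := hlarge (MA + MB)
    obtain ⟨Φ, _, h2, ⟨ρ, hρ, h3⟩, h4⟩ := package hc ha hb hC hT hpc hp hP0 hP hCc hδ hδ' hA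
      (hB₀.shift j) hAp (shift_periodic hB₀p)
      (fun t => by linarith [(abs_le.mp (hMA' t)).2, (abs_le.mp (hMB' t)).1])
    obtain ⟨z, hz⟩ := zero_exists h2 hρ h3
    obtain ⟨x, y, q1, _, _, q4, _⟩ := h4 z hz
    exact ⟨x, y, q1, q4⟩
  obtain ⟨M0, hM0, hM0'⟩ := periodic_bdd hT hx₀.continuous hx₀p
  -- the lowest translate above `A`
  obtain ⟨k₀, hk₀, hk₀min⟩ : ∃ k : ℤ, (∀ t, A t < x₀ t + 2 * (k : ℝ) * π) ∧
      ∀ k' : ℤ, (∀ t, A t < x₀ t + 2 * (k' : ℝ) * π) → k ≤ k' := by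
    apply Int.exists_least_of_bdd (P := fun k : ℤ => ∀ t, A t < x₀ t + 2 * (k : ℝ) * π)
    · obtain ⟨j, hj⟩ := hlarge (MA + M0)
      refine ⟨-j, fun k hk => ?_⟩
      by_contra hlt
      push Not at hlt
      have := hmono hlt.le
      push_cast at this
      linarith [hk 0, (abs_le.mp (hMA' 0)).1, (abs_le.mp (hM0' 0)).2]
    · obtain ⟨j, hj⟩ := hlarge (MA + M0)
      exact ⟨j, fun t => by linarith [(abs_le.mp (hMA' t)).2, (abs_le.mp (hM0' t)).1]⟩
  obtain ⟨j₀, hj₀, hj₀min⟩ : ∃ k : ℤ, (∀ t, x₀ t + 2 * (k₀ : ℝ) * π < B₀ t + 2 * (k : ℝ) * π) ∧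
      ∀ k' : ℤ, (∀ t, x₀ t + 2 * (k₀ : ℝ) * π < B₀ t + 2 * (k' : ℝ) * π) → k ≤ k' := by
    apply Int.exists_least_of_bdd
      (P := fun k : ℤ => ∀ t, x₀ t + 2 * (k₀ : ℝ) * π < B₀ t + 2 * (k : ℝ) * π)
    · obtain ⟨j, hj⟩ := hlarge (MB + M0 - 2 * (k₀ : ℝ) * π)
      refine ⟨-j, fun k hk => ?_⟩
      by_contra hlt
      push Not at hlt
      have := hmono hlt.le
      push_cast at this
      linarith [hk 0, (abs_le.mp (hMB' 0)).2, (abs_le.mp (hM0' 0)).1]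
    · obtain ⟨j, hj⟩ := hlarge (MB + M0 + 2 * (k₀ : ℝ) * π)
      exact ⟨j, fun t => by linarith [(abs_le.mp (hMB' t)).1, (abs_le.mp (hM0' t)).2]⟩
  obtain ⟨x, hx⟩ : ∃ x : ℝ → ℝ, x = fun t => x₀ t + 2 * (k₀ : ℝ) * π := ⟨_, rfl⟩
  obtain ⟨B, hB⟩ : ∃ B : ℝ → ℝ, B = fun t => B₀ t + 2 * (j₀ : ℝ) * π := ⟨_, rfl⟩
  have hxT : Traj c a b p x y₀ := hx ▸ hx₀.shift k₀
  have hBT : Traj c a b (fun t => p t - δ') B yB := hB ▸ hB₀.shift j₀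
  have hxp : Function.Periodic x T := hx ▸ shift_periodic hx₀p
  have hBp : Function.Periodic B T := hB ▸ shift_periodic hB₀p
  have hAx : ∀ t, A t < x t := by rw [hx]; exact hk₀
  have hxB : ∀ t, x t < B t := by rw [hx, hB]; exact hj₀
  have hlow : ∀ k : ℤ, (∀ t, A t < x t + 2 * (k : ℝ) * π) → 0 ≤ k := by
    intro k hk
    have := hk₀min (k₀ + k) (fun t => by
      have := hk t; rw [hx] at this; push_cast; linarith)
    linarith
  have hup : ∀ k : ℤ, (∀ t, x t + 2 * (k : ℝ) * π < B t) → k ≤ 0 := by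
    intro k hk
    have := hj₀min (j₀ - k) (fun t => by
      have := hk t; rw [hx, hB] at this; push_cast; linarith)
    linarith
  have sh : ∀ {q x y : ℝ → ℝ}, Traj c a b q x y → Traj c a b q (fun t => x t + 2 * π) y := by
    intro q x y h
    simpa using h.shift 1
  have hAB : ∀ t, A t ≤ B t := fun t => ((hAx t).trans (hxB t)).le
  have hsol : IsPendSol c a b T p x := hxT.pendSol hc hpc hxp
  -- classification of solutions
  have hclass : ∀ x' y' : ℝ → ℝ, Function.Periodic x' T → Traj c a b p x' y' →
      ∃ k : ℤ, (∀ t, x' t = x t + 2 * (k : ℝ) * π) ∧ y' 0 = y₀ 0 := by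
    intro x' y' h1 h2
    obtain ⟨k, hk⟩ := huniq x' x (h2.pendSol hc hpc h1) hsol
    exact ⟨k, hk, h2.y_unique hxT hk 0⟩
  obtain ⟨Φ₁, f₁, c₁, s₁, z₁⟩ := package hc ha hb hC hT hpc hp hP0 hP hCc hδ hδ' hA hBT hAp hBp hAB
  obtain ⟨Φ₂, f₂, c₂, s₂, z₂⟩ := package hc ha hb hC hT hpc hp hP0 hP hCc hδ hδ' hA (sh hBT) hAp
    (shift_periodic hBp) (fun t => by linarith [hAB t])
  obtain ⟨Φ₃, f₃, c₃, s₃, z₃⟩ := package hc ha hb hC hT hpc hp hP0 hP hCc hδ hδ' (sh hA) (sh hBT)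
    (shift_periodic hAp) (shift_periodic hBp) (fun t => by linarith [hAB t])
  refine triple (z₁ := ⟨x 0, y₀ 0⟩) (z₃ := ⟨x 0 + 2 * π, y₀ 0⟩) c₁ c₂ c₃ s₁ s₂ s₃ ?_ ?_ ?_ ?_ ?_ ?_
  · intro h
    have := congrArg Complex.re h
    simp at this
  · intro z hz
    obtain ⟨x', y', q1, q2, q3, q4, rfl⟩ := z₁ z hz
    obtain ⟨k, hk, hy⟩ := hclass x' y' q1 q4
    have h1 := hlow k (fun t => by rw [← hk]; exact q2 t)
    have h2 := hup k (fun t => by rw [← hk]; exact q3 t)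
    have h3 : k = 0 := le_antisymm h2 h1
    rw [hk, hy, h3]; simp
  · intro z hz
    obtain ⟨x', y', q1, q2, q3, q4, rfl⟩ := z₃ z hz
    obtain ⟨k, hk, hy⟩ := hclass x' y' q1 q4
    have h1 := hlow (k - 1) (fun t => by have := q2 t; rw [hk] at this; push_cast; linarith)
    have h2 := hup (k - 1) (fun t => by have := q3 t; rw [hk] at this; push_cast; linarith)
    have h3 : k = 1 := by linarith
    rw [hk, hy, h3]; simp
  · intro z hz
    obtain ⟨x', y', q1, q2, q3, q4, rfl⟩ := z₂ z hz
    obtain ⟨k, hk, hy⟩ := hclass x' y' q1 q4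
    have h1 := hlow k (fun t => by rw [← hk]; exact q2 t)
    have h2 := hup (k - 1) (fun t => by have := q3 t; rw [hk] at this; push_cast; linarith)
    have h3 : k = 0 ∨ k = 1 := by omega
    rcases h3 with h3 | h3
    · left; rw [hk, hy, h3]; simp
    · right; rw [hk, hy, h3]; simp
  · have := flow_local_eq f₁ f₂ (fld_lipschitz ha hb hC _ _ _) (fld_lipschitz ha hb hC _ _ _) hT.le
      hA.continuous hBT.continuous
      (fun t z h1 h2 => fld_agree t z h1 h2 h1 (by linarith))
      (fld_sol hxT hAx hxB) hAx hxB
    filter_upwards [this] with z hz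
    rw [hz]
  · have := flow_local_eq f₃ f₂ (fld_lipschitz ha hb hC _ _ _) (fld_lipschitz ha hb hC _ _ _) hT.le
      (sh hA).continuous (sh hBT).continuous
      (fun t z h1 h2 => fld_agree t z h1 h2 (by linarith) h2)
      (fld_sol (sh hxT) (fun t => by linarith [hAx t]) (fun t => by linarith [hxB t]))
      (fun t => by simpa using hAx t) (fun t => by simpa using hxB t)
    filter_upwards [this] with z hz
    rw [hz]

/-- for `s` in the interior of the solvability interval there are at least two
geometrically distinct `T`-periodic solutions. -/
theorem two_solutions_of_interior (c a b T : ℝ) (hc : 0 < c) (ha : 0 < a) (hb : 0 < b)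
    (hT : 0 < T) (p₀ : ℝ → ℝ) (hp₀cont : Continuous p₀) (hp₀per : Function.Periodic p₀ T)
    (hp₀avg : (∫ t in (0:ℝ)..T, p₀ t) = 0) (s : ℝ)
    (hs₁ : sInf (solvSet c a b T p₀) < s) (hs₂ : s < sSup (solvSet c a b T p₀)) :
    ∃ x₁ x₂ : ℝ → ℝ,
      IsPendSol c a b T (fun t => p₀ t + s) x₁ ∧
      IsPendSol c a b T (fun t => p₀ t + s) x₂ ∧
      ∀ k : ℤ, ¬ (∀ t : ℝ, x₁ t = x₂ t + 2 * (k : ℝ) * Real.pi) := by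
  have hne : (solvSet c a b T p₀).Nonempty := by
    rw [Set.nonempty_iff_ne_empty]
    intro h
    rw [h] at hs₁ hs₂
    simp at hs₁ hs₂
    linarith
  obtain ⟨s₁, ⟨β, hβ⟩, h1⟩ := exists_lt_of_csInf_lt hne hs₁
  obtain ⟨s₂, ⟨α, hα⟩, h2⟩ := exists_lt_of_lt_csSup hne hs₂
  by_contra hcon
  push Not at hcon
  refine core (p := fun t => p₀ t + s) (δ := s₂ - s) (δ' := s - s₁) (A := α) (B₀ := β)
    hc ha hb hT (by fun_prop) (shift_periodic hp₀per) (by linarith) (by linarith)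
    (yA := fun t => phi c (deriv α t)) (yB := fun t => phi c (deriv β t)) ?_ ?_ hα.1 hβ.1 ?_
  · have := hα.traj hc
    convert this using 2
    ring
  · have := hβ.traj hc
    convert this using 2
    ring
  · intro x₁ x₂ hx₁ hx₂
    exact hcon x₁ x₂ hx₁ hx₂
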